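/- arXiv:2603.17931 — 5 statements merged into one kernel-verified Lean document; each statement's English description precedes it below -/
import Mathlib

section
/- Let γₙ be the standard Gaussian measure on ℝⁿ (the n-fold product of the real Gaussian measure with mean 0 and variance 1). For all s, t > 0 with s + t = 1 and all Borel sets A, B ⊆ ℝⁿ such that the Minkowski combination s•A + t•B is measurable, one has γₙ(s•A + t•B) ≥ γₙ(A)^s · γₙ(B)^t; that is, γₙ is a log-concave measure. -/
open MeasureTheory ProbabilityTheory Pointwise

/-- The standard Gaussian measure on `ℝⁿ`: the `n`-fold product of the real
Gaussian measure with mean `0` and variance `1`. -/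
noncomputable def stdGaussianPi (n : ℕ) : Measure (Fin n → ℝ) :=
  Measure.pi fun _ => gaussianReal 0 1

lemma bm_compact (K L : Set ℝ) (hK : IsCompact K) (hL : IsCompact L)
    (hK0 : K.Nonempty) (hL0 : L.Nonempty) :
    volume K + volume L ≤ volume (K + L) := by
  obtain ⟨k, hk, hk'⟩ := hK.exists_isGreatest hK0
  obtain ⟨l, hl, hl'⟩ := hL.exists_isLeast hL0
  have h1 : volume ((fun x => l + x) '' K) = volume K := by
    simp
  have h2 : volume ((fun x => k + x) '' L) = volume L := by
    simp
  rw [← h1, ← h2, ← measure_union₀']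
  · apply measure_mono
    rintro x (⟨y, hy, rfl⟩ | ⟨y, hy, rfl⟩)
    · exact ⟨y, hy, l, hl, add_comm _ _⟩
    · exact ⟨k, hk, y, hy, rfl⟩
  · exact (hK.image (by fun_prop)).measurableSet.nullMeasurableSet
  · refine measure_mono_null (t := {k + l}) ?_ (by simp)
    rintro x ⟨⟨y, hy, rfl⟩, ⟨z, hz, hzy⟩⟩
    have a1 := hk' hy
    have a2 := hl' hz
    simp only at hzy
    simp only [Set.mem_singleton_iff]
    linarith

lemma bm_add (A B : Set ℝ) (hA : MeasurableSet A) (hB : MeasurableSet B)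
    (hA0 : A.Nonempty) (hB0 : B.Nonempty) :
    volume A + volume B ≤ volume (A + B) := by
  rw [hA.measure_eq_iSup_isCompact, hB.measure_eq_iSup_isCompact]
  obtain ⟨a, ha⟩ := hA0
  obtain ⟨b, hb⟩ := hB0
  have key : ∀ K ⊆ A, IsCompact K → ∀ L ⊆ B, IsCompact L →
      volume K + volume L ≤ volume (A + B) := by
    intro K hKA hK L hLB hL
    calc volume K + volume L ≤ volume (insert a K) + volume (insert b L) := by
          gcongr <;> exact Set.subset_insert _ _
      _ ≤ volume (insert a K + insert b L) :=
          bm_compact _ _ (hK.insert a) (hL.insert b) (Set.insert_nonempty _ _)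
            (Set.insert_nonempty _ _)
      _ ≤ _ := by
          apply measure_mono
          exact Set.add_subset_add (Set.insert_subset ha hKA) (Set.insert_subset hb hLB)
  simp only [iSup_and', iSup_subtype']
  have : Nonempty {K : Set ℝ // K ⊆ A ∧ IsCompact K} := ⟨⟨∅, by simp⟩⟩
  have : Nonempty {K : Set ℝ // K ⊆ B ∧ IsCompact K} := ⟨⟨∅, by simp⟩⟩
  rw [ENNReal.iSup_add]
  refine iSup_le fun K => ?_
  rw [ENNReal.add_iSup]
  exact iSup_le fun L => key K.1 K.2.1 K.2.2 L.1 L.2.1 L.2.2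

lemma bm1 {s t : ℝ} (hs : 0 < s) (ht : 0 < t) (A B : Set ℝ) (hA : MeasurableSet A)
    (hB : MeasurableSet B) (hA0 : A.Nonempty) (hB0 : B.Nonempty) :
    ENNReal.ofReal s * volume A + ENNReal.ofReal t * volume B ≤ volume (s • A + t • B) := by
  have := bm_add (s • A) (t • B) (hA.const_smul₀ s) (hB.const_smul₀ t)
    (hA0.smul_set) (hB0.smul_set)
  simpa [Measure.addHaar_smul, abs_of_pos hs, abs_of_pos ht] using this

lemma layer (f : ℝ → ENNReal) (hf : Measurable f) (h1 : ∀ x, f x ≤ 1) :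
    ∫⁻ x, f x = ∫⁻ u in Set.Ioo (0:ℝ) 1, volume {x | ENNReal.ofReal u < f x} := by
  have hfin : ∀ x, f x ≠ ⊤ := fun x => ((h1 x).trans_lt ENNReal.one_lt_top).ne
  have h := lintegral_eq_lintegral_meas_lt (f := fun x => (f x).toReal) volume
    (Filter.Eventually.of_forall fun x => ENNReal.toReal_nonneg) hf.ennreal_toReal.aemeasurable
  simp only [ENNReal.ofReal_toReal (hfin _)] at h
  rw [h, ← Set.Ioo_union_Ici_eq_Ioi (zero_lt_one (α := ℝ)),
    lintegral_union measurableSet_Ici]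
  · have e2 : ∫⁻ u in Set.Ici (1:ℝ), volume {a | u < (f a).toReal} = 0 := by
      rw [setLIntegral_congr_fun (g := fun _ => 0) measurableSet_Ici]
      · simp
      · intro u hu
        have : {a | u < (f a).toReal} = ∅ := by
          ext a
          simp only [Set.mem_ofPred_eq, Set.mem_empty_iff_false, iff_false, not_lt]
          exact (ENNReal.toReal_mono ENNReal.one_ne_top (h1 a)).trans (by simpa using hu)
        simp [this]
    rw [e2, add_zero]
    refine setLIntegral_congr_fun measurableSet_Ioo fun u hu => ?_
    congr 1
    ext a
    exact (ENNReal.ofReal_lt_iff_lt_toReal hu.1.le (hfin a)).symm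
  · rw [Set.disjoint_left]
    intro x hx hx'
    exact absurd hx.2 (not_lt.2 hx')

lemma amgm {s t : ℝ} (hs : 0 < s) (ht : 0 < t) (hst : s + t = 1) (a b : ENNReal) :
    a ^ s * b ^ t ≤ ENNReal.ofReal s * a + ENNReal.ofReal t * b := by
  have hpq : (s⁻¹).HolderConjugate t⁻¹ := by
    rw [Real.holderConjugate_iff]
    constructor
    · exact (one_lt_inv₀ hs).2 (by linarith)
    · simpa using hst
  have := ENNReal.young_inequality (a ^ s) (b ^ t) hpq
  rw [← ENNReal.rpow_mul, ← ENNReal.rpow_mul, mul_inv_cancel₀ hs.ne', mul_inv_cancel₀ ht.ne',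
    ENNReal.rpow_one, ENNReal.rpow_one, ENNReal.ofReal_inv_of_pos hs,
    ENNReal.ofReal_inv_of_pos ht, div_eq_mul_inv, div_eq_mul_inv, inv_inv, inv_inv] at this
  rwa [mul_comm _ a, mul_comm _ b]

lemma pl_norm {s t : ℝ} (hs : 0 < s) (ht : 0 < t) (hst : s + t = 1)
    (f g h : ℝ → ENNReal) (hf : Measurable f) (hg : Measurable g) (hh : Measurable h)
    (hf1 : ⨆ x, f x = 1) (hg1 : ⨆ x, g x = 1)
    (H : ∀ x y, f x ^ s * g y ^ t ≤ h (s • x + t • y)) :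
    (∫⁻ x, f x) ^ s * (∫⁻ x, g x) ^ t ≤ ∫⁻ x, h x := by
  have hfl : ∀ x, f x ≤ 1 := fun x => hf1 ▸ le_iSup f x
  have hgl : ∀ x, g x ≤ 1 := fun x => hg1 ▸ le_iSup g x
  calc _ ≤ ENNReal.ofReal s * (∫⁻ x, f x) + ENNReal.ofReal t * ∫⁻ x, g x := amgm hs ht hst _ _
    _ ≤ ∫⁻ x, min (h x) 1 := by
      rw [layer f hf hfl, layer g hg hgl, layer _ (hh.min measurable_const) (by simp),
        ← lintegral_const_mul' _ _ (by simp), ← lintegral_const_mul' _ _ (by simp)]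
      refine (le_lintegral_add _ _).trans ?_
      refine setLIntegral_mono' measurableSet_Ioo fun u hu => ?_
      have hu1 : ENNReal.ofReal u < 1 := by simpa using hu.2
      refine (bm1 hs ht _ _ (measurableSet_lt measurable_const hf)
        (measurableSet_lt measurable_const hg) ?_ ?_).trans (measure_mono ?_)
      · exact lt_iSup_iff.1 (hf1 ▸ hu1)
      · exact lt_iSup_iff.1 (hg1 ▸ hu1)
      · rintro _ ⟨_, ⟨x, hx, rfl⟩, _, ⟨y, hy, rfl⟩, rfl⟩
        refine lt_min (lt_of_lt_of_le ?_ (H x y)) hu1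
        have : ENNReal.ofReal u = ENNReal.ofReal u ^ s * ENNReal.ofReal u ^ t := by
          rw [← ENNReal.rpow_add_of_nonneg _ _ hs.le ht.le, hst, ENNReal.rpow_one]
        rw [this]
        exact ENNReal.mul_lt_mul (ENNReal.rpow_lt_rpow hx hs) (ENNReal.rpow_lt_rpow hy ht)
    _ ≤ _ := lintegral_mono fun x => min_le_left _ _

lemma pl_bdd {s t : ℝ} (hs : 0 < s) (ht : 0 < t) (hst : s + t = 1)
    (f g h : ℝ → ENNReal) (hf : Measurable f) (hg : Measurable g) (hh : Measurable h)
    (hf1 : ⨆ x, f x ≠ ⊤) (hg1 : ⨆ x, g x ≠ ⊤)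
    (H : ∀ x y, f x ^ s * g y ^ t ≤ h (s • x + t • y)) :
    (∫⁻ x, f x) ^ s * (∫⁻ x, g x) ^ t ≤ ∫⁻ x, h x := by
  set a := ⨆ x, f x with ha
  set b := ⨆ x, g x with hb
  by_cases ha0 : a = 0
  · have : ∀ x, f x = 0 := fun x => le_antisymm (ha0 ▸ le_iSup f x) (zero_le)
    simp [this, hs]
  by_cases hb0 : b = 0
  · have : ∀ x, g x = 0 := fun x => le_antisymm (hb0 ▸ le_iSup g x) (zero_le)
    simp [this, ht]
  have k := pl_norm hs ht hst (fun x => a⁻¹ * f x) (fun x => b⁻¹ * g x)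
    (fun x => ((a⁻¹) ^ s * (b⁻¹) ^ t) * h x) (hf.const_mul _) (hg.const_mul _) (hh.const_mul _)
    (by rw [← ENNReal.mul_iSup, ← ha, ENNReal.inv_mul_cancel ha0 hf1])
    (by rw [← ENNReal.mul_iSup, ← hb, ENNReal.inv_mul_cancel hb0 hg1])
    (by
      intro x y
      rw [ENNReal.mul_rpow_of_nonneg _ _ hs.le, ENNReal.mul_rpow_of_nonneg _ _ ht.le,
        mul_mul_mul_comm]
      gcongr
      exact H x y)
  rw [lintegral_const_mul _ hf, lintegral_const_mul _ hg, lintegral_const_mul _ hh,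
    ENNReal.mul_rpow_of_nonneg _ _ hs.le, ENNReal.mul_rpow_of_nonneg _ _ ht.le,
        mul_mul_mul_comm] at k
  refine (ENNReal.mul_le_mul_iff_right ?_ ?_).1 k
  · simp [hf1, hg1, hs, ht, hs.le, ht.le]
  · apply ENNReal.mul_ne_top <;> apply ENNReal.rpow_ne_top_of_nonneg <;> simp [ha0, hb0, hs.le, ht.le]

lemma lint_trunc (f : ℝ → ENNReal) (hf : Measurable f) :
    ∫⁻ x, f x = ⨆ n : ℕ, ∫⁻ x, min (f x) n := by
  rw [← lintegral_iSup (fun n => hf.min measurable_const)]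
  · congr 1
    ext x
    rw [← inf_iSup_eq, ENNReal.iSup_natCast, inf_top_eq]
  · intro m n hmn x
    exact min_le_min le_rfl (by exact_mod_cast hmn)

/-- The Prékopa–Leindler property of a measure. -/
def PL (s t : ℝ) {E : Type} [AddCommGroup E] [Module ℝ E] [MeasurableSpace E]
    (μ : Measure E) : Prop :=
  ∀ f g h : E → ENNReal, Measurable f → Measurable g → Measurable h →
    (∀ x y, f x ^ s * g y ^ t ≤ h (s • x + t • y)) →
    (∫⁻ x, f x ∂μ) ^ s * (∫⁻ x, g x ∂μ) ^ t ≤ ∫⁻ x, h x ∂μ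

lemma PL_volume {s t : ℝ} (hs : 0 < s) (ht : 0 < t) (hst : s + t = 1) :
    PL s t (volume : Measure ℝ) := by
  intro f g h hf hg hh H
  have e : ∀ (r : ℝ) (hr : 0 < r) (u : ℕ → ENNReal), (⨆ n, u n) ^ r = ⨆ n, u n ^ r :=
    fun r hr u => (ENNReal.orderIsoRpow r hr).map_iSup u
  rw [lint_trunc f hf, lint_trunc g hg, e s hs, e t ht, ENNReal.iSup_mul]
  refine iSup_le fun m => ?_
  rw [ENNReal.mul_iSup]
  refine iSup_le fun n => ?_
  refine pl_bdd hs ht hst _ _ _ (hf.min measurable_const) (hg.min measurable_const) hh ?_ ?_ ?_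
  · exact ((iSup_le fun x => min_le_right _ _).trans_lt (ENNReal.natCast_lt_top m)).ne
  · exact ((iSup_le fun x => min_le_right _ _).trans_lt (ENNReal.natCast_lt_top n)).ne
  · intro x y
    refine le_trans ?_ (H x y)
    gcongr <;> exact min_le_left _ _

lemma pdf_logconcave {s t : ℝ} (hs : 0 < s) (ht : 0 < t) (hst : s + t = 1) (x y : ℝ) :
    gaussianPDF 0 1 x ^ s * gaussianPDF 0 1 y ^ t ≤ gaussianPDF 0 1 (s • x + t • y) := by
  have hp : ∀ z, 0 < gaussianPDFReal 0 1 z := fun z => gaussianPDFReal_pos 0 1 z one_ne_zero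
  simp only [gaussianPDF]
  rw [ENNReal.ofReal_rpow_of_pos (hp x), ENNReal.ofReal_rpow_of_pos (hp y),
    ← ENNReal.ofReal_mul (Real.rpow_nonneg (hp x).le _)]
  apply ENNReal.ofReal_le_ofReal
  simp only [gaussianPDFReal]
  set c := (√(2 * Real.pi * ((1 : NNReal) : ℝ)))⁻¹ with hc
  have hc0 : 0 < c := by simp only [hc]; positivity
  rw [Real.mul_rpow hc0.le (Real.exp_pos _).le, Real.mul_rpow hc0.le (Real.exp_pos _).le,
    mul_mul_mul_comm, ← Real.rpow_add hc0, hst, Real.rpow_one, ← Real.exp_mul, ← Real.exp_mul,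
    ← Real.exp_add]
  gcongr
  simp only [sub_zero, NNReal.coe_one, mul_one, smul_eq_mul]
  obtain rfl : t = 1 - s := by linarith
  nlinarith [mul_nonneg (mul_pos hs ht).le (sq_nonneg (x - y))]

lemma PL_gauss {s t : ℝ} (hs : 0 < s) (ht : 0 < t) (hst : s + t = 1) :
    PL s t (gaussianReal 0 1) := by
  intro f g h hf hg hh H
  have hm := measurable_gaussianPDF 0 1
  rw [gaussianReal_of_var_ne_zero _ one_ne_zero,
    lintegral_withDensity_eq_lintegral_mul _ hm hf,
    lintegral_withDensity_eq_lintegral_mul _ hm hg,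
    lintegral_withDensity_eq_lintegral_mul _ hm hh]
  refine PL_volume hs ht hst _ _ _ (hm.mul hf) (hm.mul hg) (hm.mul hh) fun x y => ?_
  simp only [Pi.mul_apply]
  rw [ENNReal.mul_rpow_of_nonneg _ _ hs.le, ENNReal.mul_rpow_of_nonneg _ _ ht.le,
    mul_mul_mul_comm]
  exact mul_le_mul' (pdf_logconcave hs ht hst x y) (H x y)

lemma PL_prod {s t : ℝ} {E F : Type} [AddCommGroup E] [Module ℝ E] [MeasurableSpace E]
    [AddCommGroup F] [Module ℝ F] [MeasurableSpace F] (μ : Measure E) (ν : Measure F)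
    [SFinite ν] (hμ : PL s t μ) (hν : PL s t ν) : PL s t (μ.prod ν) := by
  intro f g h hf hg hh H
  rw [lintegral_prod _ hf.aemeasurable, lintegral_prod _ hg.aemeasurable,
    lintegral_prod _ hh.aemeasurable]
  refine hμ _ _ _ hf.lintegral_prod_right' hg.lintegral_prod_right' hh.lintegral_prod_right' ?_
  intro x y
  refine hν _ _ _ (hf.comp measurable_prodMk_left) (hg.comp measurable_prodMk_left)
    (hh.comp measurable_prodMk_left) ?_
  intro x' y'
  exact H (x, x') (y, y')

lemma PL_pi {s t : ℝ} (hs : 0 < s) (ht : 0 < t) (hst : s + t = 1) (n : ℕ) :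
    PL s t (stdGaussianPi n) := by
  induction n with
  | zero =>
    intro f g h hf hg hh H
    simp only [stdGaussianPi]
    rw [Measure.pi_of_empty, lintegral_dirac' _ hf, lintegral_dirac' _ hg, lintegral_dirac' _ hh]
    exact (H _ _).trans_eq (congrArg h (Subsingleton.elim _ _))
  | succ n ih =>
    intro f g h hf hg hh H
    have mp := (measurePreserving_piFinSuccAbove
      (fun _ : Fin (n + 1) => gaussianReal 0 1) 0).symm
    have hm := mp.measurable
    simp only [stdGaussianPi]
    rw [← mp.lintegral_comp hf, ← mp.lintegral_comp hg, ← mp.lintegral_comp hh]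
    have : SFinite (stdGaussianPi n) := by unfold stdGaussianPi; infer_instance
    refine PL_prod (gaussianReal 0 1) (stdGaussianPi n) (PL_gauss hs ht hst) ih _ _ _ (hf.comp hm) (hg.comp hm) (hh.comp hm) ?_
    intro x y
    refine (H _ _).trans_eq (congrArg h ?_)
    ext i
    refine Fin.cases ?_ (fun j => ?_) i <;>
      simp [MeasurableEquiv.piFinSuccAbove, Fin.insertNthEquiv]

/-- **Prékopa–Leindler-type log-concavity of the standard Gaussian measure.**
For `s, t > 0` with `s + t = 1` and Borel sets `A, B ⊆ ℝⁿ` whose Minkowski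
combination `s•A + t•B` is measurable,
`γₙ(s•A + t•B) ≥ γₙ(A)^s * γₙ(B)^t`. -/
theorem stdGaussianPi_logConcave (n : ℕ) (s t : ℝ) (hs : 0 < s) (ht : 0 < t)
    (hst : s + t = 1) (A B : Set (Fin n → ℝ))
    (hA : MeasurableSet A) (hB : MeasurableSet B)
    (hAB : MeasurableSet (s • A + t • B)) :
    stdGaussianPi n A ^ s * stdGaussianPi n B ^ t ≤ stdGaussianPi n (s • A + t • B) := by
  have := PL_pi hs ht hst n (A.indicator 1) (B.indicator 1) ((s • A + t • B).indicator 1)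
    (measurable_one.indicator hA) (measurable_one.indicator hB) (measurable_one.indicator hAB) ?_
  · rwa [lintegral_indicator_one hA, lintegral_indicator_one hB, lintegral_indicator_one hAB]
      at this
  · intro x y
    by_cases hx : x ∈ A
    · by_cases hy : y ∈ B
      · have : s • x + t • y ∈ s • A + t • B :=
          Set.add_mem_add (Set.smul_mem_smul_set hx) (Set.smul_mem_smul_set hy)
        simp [hx, hy, this]
      · simp [hy, ht]
    · simp [hx, hs]
end

section
/- Let μ be a log-concave probability measure on ℝⁿ (i.e., μ(s•A + t•B) ≥ μ(A)^s · μ(B)^t for all s, t > 0 with s + t = 1 and all Borel A, B with s•A + t•B measurable). Let E be a real vector space, a, b : E → ℝⁿ affine maps, and define F : E → ℝ by F(x) = μ(Rect(x)) where Rect(x) = {q ∈ ℝⁿ : aᵢ(x) ≤ qᵢ ≤ bᵢ(x) for all i}. Then F is log-concave: F((1−t)·x + t·y) ≥ F(x)^(1−t) · F(y)^t for all x, y ∈ E and t ∈ [0,1]. -/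
open MeasureTheory Pointwise

/-- The moving rectangle `Rect(x) = {q ∈ ℝⁿ : aᵢ(x) ≤ qᵢ ≤ bᵢ(x) for all i}`
determined by affine maps `a, b : E → ℝⁿ`. -/
def movingRect {E : Type*} [AddCommGroup E] [Module ℝ E] {n : ℕ}
    (a b : E →ᵃ[ℝ] (Fin n → ℝ)) (x : E) : Set (Fin n → ℝ) :=
  {q | ∀ i, a x i ≤ q i ∧ q i ≤ b x i}

/-- **Log-concavity of the probability of a moving rectangle.**
If `μ` is a log-concave probability measure on `ℝⁿ` and `a, b : E → ℝⁿ` are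
affine, then `F x = μ(Rect x)` is a log-concave function of `x`. -/
theorem movingRect_prob_logConcave
    {E : Type*} [AddCommGroup E] [Module ℝ E] {n : ℕ}
    (μ : Measure (Fin n → ℝ)) [IsProbabilityMeasure μ]
    (hμ : ∀ s t : ℝ, 0 < s → 0 < t → s + t = 1 →
      ∀ A B : Set (Fin n → ℝ), MeasurableSet A → MeasurableSet B →
        MeasurableSet (s • A + t • B) →
        μ A ^ s * μ B ^ t ≤ μ (s • A + t • B))
    (a b : E →ᵃ[ℝ] (Fin n → ℝ))
    (F : E → ℝ) (hF : ∀ x, F x = (μ (movingRect a b x)).toReal) :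
    ∀ x y : E, ∀ t : ℝ, t ∈ Set.Icc (0 : ℝ) 1 →
      F x ^ (1 - t) * F y ^ t ≤ F ((1 - t) • x + t • y) := by
  have hI : ∀ x, movingRect a b x = Set.Icc (a x) (b x) := by
    intro x
    ext q
    simp only [movingRect, Set.mem_setOf_eq, Set.mem_Icc, Pi.le_def, forall_and]
  have haff : ∀ (f : E →ᵃ[ℝ] (Fin n → ℝ)) (x y : E) (t : ℝ),
      f ((1 - t) • x + t • y) = (1 - t) • f x + t • f y := by
    intro f x y t
    exact Convex.combo_affine_apply (by ring)
  rintro x y t ⟨ht0, ht1⟩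
  rcases ht0.eq_or_lt with rfl | ht0
  · simp
  rcases ht1.eq_or_lt with rfl | ht1
  · simp
  have hs : 0 < 1 - t := by linarith
  have hc : ∀ x, IsCompact (movingRect a b x) := by
    intro x
    rw [hI]
    exact isCompact_Icc
  have key := hμ (1 - t) t hs ht0 (by ring) _ _ (hc x).measurableSet (hc y).measurableSet
    (((hc x).smul (1 - t)).add ((hc y).smul t)).measurableSet
  have hsub : (1 - t) • movingRect a b x + t • movingRect a b y ⊆
      movingRect a b ((1 - t) • x + t • y) := by
    rintro _ ⟨_, ⟨p, hp, rfl⟩, _, ⟨q, hq, rfl⟩, rfl⟩ i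
    rw [haff, haff]
    simp only [Pi.add_apply, Pi.smul_apply, smul_eq_mul]
    exact ⟨add_le_add (mul_le_mul_of_nonneg_left (hp i).1 hs.le)
        (mul_le_mul_of_nonneg_left (hq i).1 ht0.le),
      add_le_add (mul_le_mul_of_nonneg_left (hp i).2 hs.le)
        (mul_le_mul_of_nonneg_left (hq i).2 ht0.le)⟩
  have h2 := ENNReal.toReal_mono (measure_ne_top μ _) (key.trans (measure_mono hsub))
  rw [ENNReal.toReal_mul, ← ENNReal.toReal_rpow, ← ENNReal.toReal_rpow] at h2
  rw [hF, hF, hF]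
  exact h2
end

section
/- Let μ be a log-concave probability measure on ℝⁿ, E a real vector space, a, b : E → ℝⁿ affine maps, and F(x) = μ({q ∈ ℝⁿ : aᵢ(x) ≤ qᵢ ≤ bᵢ(x) for all i}). Then for every ε ∈ (0,1), the chance-constrained feasible region Ω = {x ∈ E : F(x) ≥ 1 − ε} is a convex set. -/
open MeasureTheory Pointwise

/-- **Convexity of the chance-constrained feasible region.**
If `μ` is a log-concave probability measure on `ℝⁿ`, `a, b : E → ℝⁿ` are
affine, and `F x = μ(Rect x)`, then for every `ε ∈ (0,1)` the feasible
region `Ω = {x | F x ≥ 1 − ε}` is convex. -/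
theorem chanceConstraint_region_convex
    {E : Type*} [AddCommGroup E] [Module ℝ E] {n : ℕ}
    (μ : Measure (Fin n → ℝ)) [IsProbabilityMeasure μ]
    (hμ : ∀ s t : ℝ, 0 < s → 0 < t → s + t = 1 →
      ∀ A B : Set (Fin n → ℝ), MeasurableSet A → MeasurableSet B →
        MeasurableSet (s • A + t • B) →
        μ A ^ s * μ B ^ t ≤ μ (s • A + t • B))
    (a b : E →ᵃ[ℝ] (Fin n → ℝ))
    (F : E → ℝ) (hF : ∀ x, F x = (μ (movingRect a b x)).toReal)
    (ε : ℝ) (hε₀ : 0 < ε) (hε₁ : ε < 1) :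
    Convex ℝ {x : E | 1 - ε ≤ F x} := by
  have hI : ∀ x, movingRect a b x = Set.Icc (a x) (b x) := by
    intro x
    ext q
    simp only [movingRect, Set.mem_setOf_eq, Set.mem_Icc, Pi.le_def]
    exact forall_and
  have key : ∀ x, 1 - ε ≤ F x ↔ ENNReal.ofReal (1 - ε) ≤ μ (Set.Icc (a x) (b x)) := by
    intro x
    rw [hF, hI, ENNReal.ofReal_le_iff_le_toReal (measure_ne_top _ _)]
  rw [convex_iff_forall_pos]
  intro x hx y hy s t hs ht hst
  rw [Set.mem_setOf_eq, key] at hx hy ⊢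
  have hc : ∀ f : E →ᵃ[ℝ] (Fin n → ℝ), f (s • x + t • y) = s • f x + t • f y :=
    fun f => Convex.combo_affine_apply hst
  have hmeas : MeasurableSet (s • Set.Icc (a x) (b x) + t • Set.Icc (a y) (b y)) :=
    ((isCompact_Icc.smul s).add (isCompact_Icc.smul t)).measurableSet
  have h := hμ s t hs ht hst _ _ measurableSet_Icc measurableSet_Icc hmeas
  have hsub : s • Set.Icc (a x) (b x) + t • Set.Icc (a y) (b y) ⊆
      Set.Icc (a (s • x + t • y)) (b (s • x + t • y)) := by
    rintro _ ⟨_, ⟨p, hp, rfl⟩, _, ⟨q, hq, rfl⟩, rfl⟩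
    rw [hc, hc]
    exact ⟨add_le_add (smul_le_smul_of_nonneg_left hp.1 hs.le)
        (smul_le_smul_of_nonneg_left hq.1 ht.le),
      add_le_add (smul_le_smul_of_nonneg_left hp.2 hs.le)
        (smul_le_smul_of_nonneg_left hq.2 ht.le)⟩
  have hpos : ENNReal.ofReal (1 - ε) ≠ 0 := by
    rw [Ne, ENNReal.ofReal_eq_zero]
    linarith
  calc ENNReal.ofReal (1 - ε)
      = ENNReal.ofReal (1 - ε) ^ s * ENNReal.ofReal (1 - ε) ^ t := by
        rw [← ENNReal.rpow_add _ _ hpos ENNReal.ofReal_ne_top, hst, ENNReal.rpow_one]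
    _ ≤ μ (Set.Icc (a x) (b x)) ^ s * μ (Set.Icc (a y) (b y)) ^ t :=
        mul_le_mul' (ENNReal.rpow_le_rpow hx hs.le) (ENNReal.rpow_le_rpow hy ht.le)
    _ ≤ _ := h
    _ ≤ _ := measure_mono hsub
end

section
/- Let E be a real normed vector space, F : E → ℝ a concave function, p ∈ ℝ, and x, y ∈ E with F(y) > p. Let λ ∈ (0,1) and z = (1−λ)·x + λ·y, and suppose F(z) = p and F is Fréchet differentiable at z with derivative DF(z). Then DF(z)(x − z) < 0; that is, the supporting hyperplane cut DF(z)(· − z) ≥ 0 strictly separates x from the superlevel set {w : F(w) ≥ p}. -/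
/-- **Strict separation by the supporting hyperplane cut.**
Let `F : E → ℝ` be concave, `F y > p`, `λ ∈ (0,1)`,
`z = (1−λ)•x + λ•y` with `F z = p`, and suppose `F` is Fréchet
differentiable at `z` with derivative `DF`. Then `DF (x − z) < 0`:
the cut `DF (· − z) ≥ 0` strictly separates `x` from the superlevel
set `{w | F w ≥ p}`. -/
theorem cut_strictly_separates_of_concave
    {E : Type*} [NormedAddCommGroup E] [NormedSpace ℝ E]
    (F : E → ℝ) (hF : ConcaveOn ℝ Set.univ F)
    (p : ℝ) (x y : E) (hy : p < F y)
    (lam : ℝ) (hlam₀ : 0 < lam) (hlam₁ : lam < 1)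
    (z : E) (hz : z = (1 - lam) • x + lam • y) (hFz : F z = p)
    (DF : E →L[ℝ] ℝ) (hDF : HasFDerivAt F DF z) :
    DF (x - z) < 0 := by
  have hg : ConcaveOn ℝ Set.univ (F ∘ (AffineMap.lineMap z y : ℝ →ᵃ[ℝ] E)) := by
    simpa using hF.comp_affineMap (AffineMap.lineMap z y : ℝ →ᵃ[ℝ] E)
  have hd : HasDerivAt (F ∘ (AffineMap.lineMap z y : ℝ →ᵃ[ℝ] E)) (DF (y - z)) 0 := by
    have h1 : HasDerivAt (AffineMap.lineMap z y : ℝ →ᵃ[ℝ] E) (y - z) (0 : ℝ) :=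
      AffineMap.hasDerivAt_lineMap
    have h2 : HasFDerivAt F DF ((AffineMap.lineMap z y : ℝ →ᵃ[ℝ] E) (0 : ℝ)) := by
      simpa using hDF
    exact h2.comp_hasDerivAt (0 : ℝ) h1
  have hs := hg.slope_le_of_hasDerivAt (Set.mem_univ 0) (Set.mem_univ 1) zero_lt_one hd
  simp [slope_def_field] at hs
  have e1 : y - z = (1 - lam) • (y - x) := by rw [hz]; module
  have e2 : x - z = -(lam • (y - x)) := by rw [hz]; module
  have hpos : 0 < (1 - lam) * DF (y - x) := by
    have h3 : DF (y - z) = (1 - lam) * DF (y - x) := by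
      rw [e1, map_smul, smul_eq_mul]
    rw [← h3, map_sub]
    linarith
  have hpos' : 0 < DF (y - x) := pos_of_mul_pos_right hpos (by linarith)
  rw [e2, map_neg, map_smul, smul_eq_mul]
  have := mul_pos hlam₀ hpos'
  linarith
end

section
/- Let ι be a finite type with N = |ι| ≥ 1 elements, F : (ι → ℝ) → ℝ invariant under coordinate permutations (F(x ∘ σ) = F(x) for every permutation σ of ι and every x), c ∈ ℝ, v₀ : ι → ℝ the constant function v₀(i) = c, and suppose F is Fréchet differentiable at v₀ with derivative DF(v₀) and that DF(v₀)(eᵢ₀) ≠ 0 for some i₀ ∈ ι. Then for every i ∈ ι, the normalized attribution αᵢ = |DF(v₀)(eᵢ)| / Σⱼ∈ι |DF(v₀)(eⱼ)| equals 1/N; consequently, for any total risk budget ε, the allocated risk εᵢ = ε·αᵢ equals ε/N for every i. -/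
/-- **Uniform risk allocation under symmetric steady-state (Proposition 1).**
If `F : ℝ^ι → ℝ` is permutation-invariant, Fréchet differentiable at the
constant vector `v₀ = (c, …, c)` with derivative `DF`, and some partial
derivative `DF eᵢ₀` is nonzero, then the normalized attribution
`αᵢ = |DF eᵢ| / Σⱼ |DF eⱼ|` equals `1/N` for every `i`, and consequently
the allocated risk `εᵢ = ε·αᵢ` equals `ε/N` for every risk budget `ε`. -/
theorem uniform_risk_allocation_of_permInvariant
    {ι : Type*} [Fintype ι] [DecidableEq ι] (hN : 1 ≤ Fintype.card ι)
    (F : (ι → ℝ) → ℝ)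
    (hsymm : ∀ σ : Equiv.Perm ι, ∀ x : ι → ℝ, F (x ∘ σ) = F x)
    (c : ℝ) (v₀ : ι → ℝ) (hv₀ : v₀ = fun _ => c)
    (DF : (ι → ℝ) →L[ℝ] ℝ) (hDF : HasFDerivAt F DF v₀)
    (i₀ : ι) (hi₀ : DF (Pi.single i₀ 1) ≠ 0) :
    ∀ i : ι,
      |DF (Pi.single i 1)| / (∑ j : ι, |DF (Pi.single j 1)|) =
        1 / (Fintype.card ι : ℝ) ∧
      ∀ ε : ℝ,
        ε * (|DF (Pi.single i 1)| / (∑ j : ι, |DF (Pi.single j 1)|)) =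
          ε / (Fintype.card ι : ℝ) := by
  have key : ∀ i : ι, DF (Pi.single i 1) = DF (Pi.single i₀ 1) := by
    intro i
    have h1 : HasDerivAt (fun t : ℝ => F (v₀ + t • Pi.single i 1)) (DF (Pi.single i 1)) 0 :=
      hDF.hasLineDerivAt (Pi.single i 1)
    have h2 : HasDerivAt (fun t : ℝ => F (v₀ + t • Pi.single i₀ 1)) (DF (Pi.single i₀ 1)) 0 :=
      hDF.hasLineDerivAt (Pi.single i₀ 1)
    have h3 : (fun t : ℝ => F (v₀ + t • Pi.single i 1)) =
        fun t : ℝ => F (v₀ + t • Pi.single i₀ 1) := by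
      funext t
      rw [← hsymm (Equiv.swap i i₀) (v₀ + t • Pi.single i 1)]
      congr 1
      funext k
      have h4 : Equiv.swap i i₀ k = i ↔ k = i₀ := by
        rw [Equiv.apply_eq_iff_eq_symm_apply]
        simp
      simp [hv₀, Pi.single_apply, h4]
    rw [h3] at h1
    exact h1.unique h2
  have hN' : (Fintype.card ι : ℝ) ≠ 0 := by
    have : Fintype.card ι ≠ 0 := by omega
    exact_mod_cast this
  have ha : |DF (Pi.single i₀ 1)| ≠ 0 := abs_ne_zero.mpr hi₀
  intro i
  have h : |DF (Pi.single i 1)| / (∑ j : ι, |DF (Pi.single j 1)|) =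
      1 / (Fintype.card ι : ℝ) := by
    simp only [key, Finset.sum_const, Finset.card_univ, nsmul_eq_mul]
    field_simp
  refine ⟨h, fun ε => ?_⟩
  rw [h, mul_one_div]
end
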